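/- arXiv:2303.01095 — 2 statements merged into one kernel-verified Lean document; each statement's English description precedes it below -/
import Mathlib

section
/- For every real x ≠ 0 and every m ≥ 1, the integral over R of (s₊(x,t) − s(x))/(2(πmt)²) dt equals (1 − πx sin(πx) − cos(πx))/(2(πmx)²), where s(u) = sin(πu)/(πu) and s₊(x,t) = ½(s(x−t)+s(x+t)). In particular ∫_R (½(sin(π(x−t))/(π(x−t)) + sin(π(x+t))/(π(x+t))) − sin(πx)/(πx)) / (2π²t²) dt = (1 − πx sin(πx) − cos(πx))/(2π²x²). -/
open Real MeasureTheory

open Set Filter Topology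

lemma aux_bound (y : ℝ) : 1 - cos y ≤ y ^ 2 / 2 := by
  have := Real.one_sub_sq_div_two_le_cos (x := y)
  linarith

/-- pointwise bound for the kernel -/
lemma aux_bound2 (a t : ℝ) (ha : |a| ≤ π) :
    (1 - cos (a * t)) / t ^ 2 ≤ (2 + π ^ 2) * (1 + t ^ 2)⁻¹ := by
  have hp : (0:ℝ) < 1 + t ^ 2 := by positivity
  rcases eq_or_ne t 0 with rfl | ht
  · simp; positivity
  have ht2 : 0 < t ^ 2 := by positivity
  rw [← div_eq_mul_inv, div_le_div_iff₀ ht2 hp]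
  have h1 := aux_bound (a * t)
  have h2 : 1 - cos (a * t) ≤ 2 := by linarith [neg_one_le_cos (a * t)]
  have h3 : a ^ 2 ≤ π ^ 2 := sq_le_sq' (by linarith [abs_le.mp ha]) (abs_le.mp ha).2
  have h4 : (a * t) ^ 2 ≤ π ^ 2 * t ^ 2 := by rw [mul_pow]; gcongr
  have h5 : (1 - cos (a * t)) * t ^ 2 ≤ 2 * t ^ 2 := by gcongr
  have h6 : 0 ≤ π ^ 2 * t ^ 2 := by positivity
  nlinarith

lemma aux_nonneg (a t : ℝ) : 0 ≤ (1 - cos (a * t)) / t ^ 2 :=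
  div_nonneg (by linarith [cos_le_one (a * t)]) (sq_nonneg t)

lemma aux_integrable (a : ℝ) (ha : |a| ≤ π) :
    Integrable (fun t : ℝ => (1 - cos (a * t)) / t ^ 2) := by
  refine Integrable.mono' (integrable_inv_one_add_sq.const_mul (2 + π ^ 2))
    (Measurable.aestronglyMeasurable (by fun_prop)) (ae_of_all _ fun t => ?_)
  rw [Real.norm_of_nonneg (aux_nonneg a t)]
  exact aux_bound2 a t ha

lemma aux_lap1 {t : ℝ} (ht : 0 < t) : ∫ s in Ioi (0:ℝ), s * exp (-(t * s)) = 1 / t ^ 2 := by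
  have h := Real.integral_rpow_mul_exp_neg_mul_Ioi (a := 2) (by norm_num) ht
  have e : (2:ℝ) - 1 = 1 := by norm_num
  simp only [e, rpow_one] at h
  rw [h]
  simp

lemma aux_lap2 {s : ℝ} (hs : 0 < s) :
    ∫ t in Ioi (0:ℝ), exp (-(t * s)) * (1 - cos t) = 1 / s - s / (1 + s ^ 2) := by
  have hp : (0:ℝ) < 1 + s ^ 2 := by positivity
  have hlim0 : Tendsto (fun t : ℝ => exp (-(t * s))) atTop (𝓝 0) :=
    tendsto_exp_neg_atTop_nhds_zero.comp (tendsto_id.atTop_mul_const hs)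
  have hlim : Tendsto (fun t : ℝ => exp (-(t * s)) * (-1 / s - (sin t - s * cos t) / (1 + s ^ 2)))
      atTop (𝓝 0) := by
    refine squeeze_zero_norm (a := fun t => exp (-(t * s)) * (1 / s + (1 + s) / (1 + s ^ 2)))
      (fun t => ?_) (by simpa using hlim0.mul_const (1 / s + (1 + s) / (1 + s ^ 2)))
    rw [norm_mul, Real.norm_of_nonneg (exp_pos _).le]
    gcongr
    refine (norm_sub_le _ _).trans ?_
    rw [norm_div, norm_div, Real.norm_of_nonneg hs.le, Real.norm_of_nonneg hp.le]
    simp only [norm_neg, norm_one]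
    gcongr
    refine (norm_sub_le _ _).trans ?_
    rw [norm_mul, Real.norm_of_nonneg hs.le]
    have h1 := abs_sin_le_one t
    have h2 := abs_cos_le_one t
    simp only [Real.norm_eq_abs]
    nlinarith
  have := integral_Ioi_of_hasDerivAt_of_nonneg' (a := 0)
    (g := fun t : ℝ => exp (-(t * s)) * (-1 / s - (sin t - s * cos t) / (1 + s ^ 2)))
    (g' := fun t => exp (-(t * s)) * (1 - cos t)) (l := 0) ?_ ?_ hlim
  · rw [this]; simp; ring
  · intro t _
    have h1 : HasDerivAt (fun t : ℝ => exp (-(t * s))) (exp (-(t * s)) * (-(1 * s))) t :=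
      (((hasDerivAt_id t).mul_const s).neg).exp
    have h2 : HasDerivAt (fun t : ℝ => -1 / s - (sin t - s * cos t) / (1 + s ^ 2))
        (- ((cos t - s * (-sin t)) / (1 + s ^ 2))) t :=
      (((hasDerivAt_sin t).sub ((hasDerivAt_cos t).const_mul s)).div_const _).const_sub _
    refine HasDerivAt.congr_deriv (h1.mul h2) ?_
    field_simp
    ring
  · intro t _
    exact mul_nonneg (exp_pos _).le (by linarith [cos_le_one t])

lemma aux_half : ∫ t in Ioi (0:ℝ), (1 - cos t) / t ^ 2 = π / 2 := by
  have hint : Integrable (fun t : ℝ => (1 - cos t) / t ^ 2) := by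
    simpa using aux_integrable 1 (by rw [abs_one]; linarith [pi_gt_three])
  have hsw := integral_integral_swap (μ := volume.restrict (Ioi (0:ℝ)))
    (ν := volume.restrict (Ioi (0:ℝ)))
    (f := fun t s : ℝ => (1 - cos t) * (s * exp (-(t * s)))) ?_
  · have hl : ∫ t in Ioi (0:ℝ), ∫ s in Ioi (0:ℝ), (1 - cos t) * (s * exp (-(t * s)))
        = ∫ t in Ioi (0:ℝ), (1 - cos t) / t ^ 2 := by
      refine setIntegral_congr_fun measurableSet_Ioi fun t ht => ?_
      try simp only
      rw [integral_const_mul, aux_lap1 ht]; ring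
    have hr : ∫ s in Ioi (0:ℝ), ∫ t in Ioi (0:ℝ), (1 - cos t) * (s * exp (-(t * s)))
        = ∫ s in Ioi (0:ℝ), (1 + s ^ 2)⁻¹ := by
      refine setIntegral_congr_fun measurableSet_Ioi fun s hs => ?_
      have hs' : 0 < s := hs
      have : ∀ t, (1 - cos t) * (s * exp (-(t * s))) = s * (exp (-(t * s)) * (1 - cos t)) :=
        fun t => by ring
      simp only [this]
      rw [integral_const_mul, aux_lap2 hs]
      field_simp
      ring
    rw [hl, hr, integral_Ioi_inv_one_add_sq] at hsw
    simpa using hsw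
  · refine (integrable_prod_iff ?_).2 ⟨?_, ?_⟩
    · exact Continuous.aestronglyMeasurable (by unfold Function.uncurry; fun_prop)
    · refine (ae_restrict_iff' measurableSet_Ioi).2 (ae_of_all _ fun t ht => ?_)
      have ht' : 0 < t := ht
      simp only [Function.uncurry]
      refine Integrable.const_mul ?_ _
      refine Integrable.of_integral_ne_zero ?_
      rw [aux_lap1 ht]; positivity
    · refine (hint.integrableOn (s := Ioi 0)).congr_fun (fun t ht => ?_) measurableSet_Ioi
      have : ∫ s in Ioi (0:ℝ), ‖(1 - cos t) * (s * exp (-(t * s)))‖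
          = ∫ s in Ioi (0:ℝ), (1 - cos t) * (s * exp (-(t * s))) := by
        refine setIntegral_congr_fun measurableSet_Ioi fun s hs => ?_
        have hs' : 0 < s := hs
        exact Real.norm_of_nonneg (mul_nonneg (by linarith [cos_le_one t]) (by positivity))
      simp only [Function.uncurry]
      rw [this, integral_const_mul, aux_lap1 ht]; ring

lemma aux_full : ∫ t : ℝ, (1 - cos t) / t ^ 2 = π := by
  have := integral_comp_abs (f := fun t : ℝ => (1 - cos t) / t ^ 2)
  simp only [cos_abs, sq_abs] at this
  rw [this, aux_half]; ring

lemma aux_scaled {a : ℝ} (ha : 0 < a) : ∫ t : ℝ, (1 - cos (a * t)) / t ^ 2 = π * a := by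
  have h := Measure.integral_comp_mul_left (fun t : ℝ => (1 - cos t) / t ^ 2) a
  rw [aux_full, abs_of_pos (inv_pos.2 ha), smul_eq_mul] at h
  have e : ∀ t : ℝ, (1 - cos (a * t)) / t ^ 2 = a ^ 2 * ((1 - cos (a * t)) / (a * t) ^ 2) := by
    intro t
    rcases eq_or_ne t 0 with rfl | ht
    · simp
    · field_simp
  simp only [e]
  rw [integral_const_mul, h]
  field_simp

lemma aux_sinc {u : ℝ} (hu : u ≠ 0) :
    sin (π * u) / (π * u) = ∫ v in (0:ℝ)..1, cos (π * u * v) := by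
  have h : π * u ≠ 0 := mul_ne_zero pi_ne_zero hu
  rw [intervalIntegral.integral_comp_mul_left (fun y => cos y) h, integral_cos]
  simp; field_simp

lemma aux_pt {x t : ℝ} (hx : x ≠ 0) (h1 : x - t ≠ 0) (h2 : x + t ≠ 0) :
    (sin (π * (x - t)) / (π * (x - t)) + sin (π * (x + t)) / (π * (x + t))) / 2
            - sin (π * x) / (π * x)
      = ∫ v in (0:ℝ)..1, cos (π * x * v) * (cos (π * v * t) - 1) := by
  rw [aux_sinc hx, aux_sinc h1, aux_sinc h2, ← intervalIntegral.integral_add,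
    ← intervalIntegral.integral_div, ← intervalIntegral.integral_sub]
  · refine intervalIntegral.integral_congr fun v _ => ?_
    try simp only
    rw [show π * (x - t) * v = π * x * v - π * v * t by ring,
      show π * (x + t) * v = π * x * v + π * v * t by ring, cos_sub, cos_add]
    ring
  all_goals exact Continuous.intervalIntegrable (by fun_prop) _ _

lemma aux_last {x : ℝ} (hx : x ≠ 0) :
    ∫ v in (0:ℝ)..1, cos (π * x * v) * (π * (π * v))
      = π ^ 2 * (sin (π * x) / (π * x) + (cos (π * x) - 1) / (π * x) ^ 2) := by
  have h : π * x ≠ 0 := mul_ne_zero pi_ne_zero hx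
  have hd : ∀ v ∈ uIcc (0:ℝ) 1, HasDerivAt
      (fun v => π ^ 2 * (v * sin (π * x * v) / (π * x) + cos (π * x * v) / (π * x) ^ 2))
      (cos (π * x * v) * (π * (π * v))) v := by
    intro v _
    have h0 : HasDerivAt (fun v : ℝ => π * x * v) (π * x * 1) v :=
      (hasDerivAt_id v).const_mul (π * x)
    have h1 := (((hasDerivAt_id v).mul h0.sin).div_const (π * x)).add
      (h0.cos.div_const ((π * x) ^ 2))
    refine HasDerivAt.congr_deriv (h1.const_mul (π ^ 2)) ?_
    try simp only [id]
    field_simp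
    ring
  rw [intervalIntegral.integral_eq_sub_of_hasDerivAt hd
    (Continuous.intervalIntegrable (by fun_prop) _ _)]
  simp
  ring

lemma aux_main {x : ℝ} (hx : x ≠ 0) :
    ∫ t : ℝ, ∫ v in (0:ℝ)..1, cos (π * x * v) * ((1 - cos (π * v * t)) / t ^ 2)
      = π ^ 2 * (sin (π * x) / (π * x) + (cos (π * x) - 1) / (π * x) ^ 2) := by
  simp only [intervalIntegral.integral_of_le zero_le_one]
  rw [integral_integral_swap]
  · rw [← aux_last hx, intervalIntegral.integral_of_le zero_le_one]
    refine setIntegral_congr_fun measurableSet_Ioc fun v hv => ?_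
    try simp only
    rw [integral_const_mul, aux_scaled (mul_pos pi_pos hv.1)]
  · have hg : Integrable (fun p : ℝ × ℝ => ((2 + π ^ 2) * (1 + p.1 ^ 2)⁻¹) * 1)
        (volume.prod (volume.restrict (Ioc (0:ℝ) 1))) :=
      (integrable_inv_one_add_sq.const_mul (2 + π ^ 2)).mul_prod (integrable_const (1:ℝ))
    refine hg.mono' (Measurable.aestronglyMeasurable (by unfold Function.uncurry; fun_prop)) ?_
    have : ∀ᵐ p : ℝ × ℝ ∂(volume.prod (volume.restrict (Ioc (0:ℝ) 1))), p.2 ∈ Ioc (0:ℝ) 1 :=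
      Measure.quasiMeasurePreserving_snd.ae (ae_restrict_mem measurableSet_Ioc)
    filter_upwards [this] with p hp
    simp only [Function.uncurry]
    rw [norm_mul, Real.norm_of_nonneg (aux_nonneg _ _), mul_one, Real.norm_eq_abs]
    have hb := aux_bound2 (π * p.2) p.1 (by
      rw [abs_of_pos (mul_pos pi_pos hp.1)]
      nlinarith [pi_pos, hp.2])
    refine le_trans ?_ hb
    exact mul_le_of_le_one_left (aux_nonneg _ _) (abs_cos_le_one _)

theorem stmt_4 (x : ℝ) (hx : x ≠ 0) (m : ℕ) (hm : 1 ≤ m) :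
    ∫ t : ℝ,
        ((Real.sin (π * (x - t)) / (π * (x - t)) + Real.sin (π * (x + t)) / (π * (x + t))) / 2
            - Real.sin (π * x) / (π * x)) / (2 * (π * m * t) ^ 2)
      = (1 - π * x * Real.sin (π * x) - Real.cos (π * x)) / (2 * (π * m * x) ^ 2) := by
  have hm' : (m : ℝ) ≠ 0 := by positivity
  have hae : ∀ (y : ℝ), ∀ᵐ t : ℝ, t ≠ y := fun y => by
    simp [ae_iff]
  have key : ∀ᵐ t : ℝ,
      ((sin (π * (x - t)) / (π * (x - t)) + sin (π * (x + t)) / (π * (x + t))) / 2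
            - sin (π * x) / (π * x)) / (2 * (π * m * t) ^ 2)
      = (-1 / (2 * (π * m) ^ 2)) *
        ∫ v in (0:ℝ)..1, cos (π * x * v) * ((1 - cos (π * v * t)) / t ^ 2) := by
    filter_upwards [hae x, hae (-x)] with t h1 h2
    rw [aux_pt hx (sub_ne_zero.2 h1.symm) (fun h => h2 (by linarith)),
      ← intervalIntegral.integral_div, ← intervalIntegral.integral_const_mul]
    refine intervalIntegral.integral_congr fun v _ => ?_
    try simp only
    rcases eq_or_ne t 0 with rfl | ht
    · simp
    · have := pi_ne_zero
      field_simp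
      ring
  rw [integral_congr_ae key, integral_const_mul, aux_main hx]
  have := pi_ne_zero
  field_simp
  ring
end

section
/- For each n ≥ 2 and ε > 0 there exists c(ε) > 0 such that W_n(x) = det[sin(π(x_i−x_j))/(π(x_i−x_j))]_{i,j=1}^n ≥ c(ε) for every x ∈ R^n satisfying |x_i − x_j| ≥ ε for all i ≠ j. -/
open Real

/-- The sinc kernel `s(u) = sin(πu)/(πu)` with `s(0) = 1`. -/
noncomputable def sinckernel (u : ℝ) : ℝ := if u = 0 then 1 else Real.sin (π * u) / (π * u)

/-- Dyson's limiting `n`-level correlation density for the GUE. -/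
noncomputable def Wdet (n : ℕ) (x : Fin n → ℝ) : ℝ :=
  Matrix.det (Matrix.of fun i j => sinckernel (x i - x j))

/-- The unimodular character `e(y) = exp(2πiy)`. -/
noncomputable def ech (y : ℝ) : ℂ := Complex.exp (((2 * π * y : ℝ) : ℂ) * Complex.I)

lemma ech_add (x y : ℝ) : ech (x + y) = ech x * ech y := by
  unfold ech
  rw [← Complex.exp_add]
  congr 1
  push_cast
  ring

lemma norm_ech (x : ℝ) : ‖ech x‖ = 1 := by
  unfold ech
  exact Complex.norm_exp_ofReal_mul_I _

lemma ech_re (x : ℝ) : (ech x).re = Real.cos (2 * π * x) := by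
  unfold ech
  exact Complex.exp_ofReal_mul_I_re _

lemma ech_im (x : ℝ) : (ech x).im = Real.sin (2 * π * x) := by
  unfold ech
  exact Complex.exp_ofReal_mul_I_im _

lemma continuous_ech : Continuous ech := by
  unfold ech
  fun_prop

/-- trigonometric sum -/
noncomputable def tsm {n : ℕ} (x : Fin n → ℝ) (w : Fin n → ℂ) (t : ℝ) : ℂ :=
  ∑ j, w j * ech (x j * t)

lemma continuous_tsm {n : ℕ} (x : Fin n → ℝ) (w : Fin n → ℂ) : Continuous (tsm x w) := by
  unfold tsm
  refine continuous_finsetSum _ fun j _ => continuous_const.mul (continuous_ech.comp ?_)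
  fun_prop

lemma ii_tsm {n : ℕ} (x : Fin n → ℝ) (w : Fin n → ℂ) (a b : ℝ) :
    IntervalIntegrable (fun t => ‖tsm x w t‖ ^ 2) MeasureTheory.volume a b :=
  ((continuous_tsm x w).norm.pow 2).intervalIntegrable a b

lemma mono_tsm {n : ℕ} (x : Fin n → ℝ) (w : Fin n → ℂ) (a b c d : ℝ)
    (h1 : c ≤ a) (h2 : a ≤ b) (h3 : b ≤ d) :
    ∫ t in a..b, ‖tsm x w t‖ ^ 2 ≤ ∫ t in c..d, ‖tsm x w t‖ ^ 2 := by
  apply intervalIntegral.integral_mono_interval h1 h2 h3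
  · exact Filter.Eventually.of_forall fun t => by positivity
  · exact ii_tsm x w c d

lemma one_step {n : ℕ} (x : Fin n → ℝ) (w : Fin n → ℂ) (y a δ A b : ℝ) (ha : 0 ≤ a)
    (haδ : a ≤ δ) (hAb : A ≤ b) :
    ∫ t in A..b, ‖tsm x (fun j => w j * (ech (x j * a) - ech (y * a))) t‖ ^ 2 ≤
      4 * ∫ t in A..(b + δ), ‖tsm x w t‖ ^ 2 := by
  have key : ∀ t, tsm x (fun j => w j * (ech (x j * a) - ech (y * a))) t
      = tsm x w (t + a) - ech (y * a) * tsm x w t := by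
    intro t
    unfold tsm
    rw [Finset.mul_sum, ← Finset.sum_sub_distrib]
    refine Finset.sum_congr rfl fun j _ => ?_
    rw [mul_add, ech_add]
    ring
  have hb : ∀ t, ‖tsm x (fun j => w j * (ech (x j * a) - ech (y * a))) t‖ ^ 2
      ≤ 2 * ‖tsm x w (t + a)‖ ^ 2 + 2 * ‖tsm x w t‖ ^ 2 := by
    intro t
    rw [key]
    have h := norm_sub_le (tsm x w (t + a)) (ech (y * a) * tsm x w t)
    rw [norm_mul, norm_ech, one_mul] at h
    have h0 := norm_nonneg (tsm x w (t + a) - ech (y * a) * tsm x w t)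
    nlinarith [sq_nonneg (‖tsm x w (t + a)‖ - ‖tsm x w t‖)]
  have c1 : Continuous fun t => ‖tsm x w (t + a)‖ ^ 2 :=
    ((continuous_tsm x w).comp (continuous_id.add continuous_const)).norm.pow 2
  have i1 : IntervalIntegrable (fun t => ‖tsm x w (t + a)‖ ^ 2) MeasureTheory.volume A b :=
    c1.intervalIntegrable A b
  have h1 := intervalIntegral.integral_mono_on hAb (ii_tsm x _ A b)
    ((i1.const_mul 2).add ((ii_tsm x w A b).const_mul 2)) (fun t _ => hb t)
  rw [intervalIntegral.integral_add (i1.const_mul 2) ((ii_tsm x w A b).const_mul 2),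
    intervalIntegral.integral_const_mul, intervalIntegral.integral_const_mul,
    intervalIntegral.integral_comp_add_right (fun t => ‖tsm x w t‖ ^ 2) a] at h1
  have h2 := mono_tsm x w (A + a) (b + a) A (b + δ) (by linarith) (by linarith) (by linarith)
  have h3 := mono_tsm x w A b A (b + δ) le_rfl hAb (by linarith)
  linarith

lemma multi_step {n : ℕ} (x : Fin n → ℝ) (a : Fin n → ℝ) (δ A : ℝ) (ha : ∀ k, 0 ≤ a k)
    (haδ : ∀ k, a k ≤ δ) (hδ : 0 ≤ δ) (S : Finset (Fin n)) :
    ∀ (w : Fin n → ℂ) (b : ℝ), A ≤ b →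
    ∫ t in A..b, ‖tsm x (fun j => w j * ∏ k ∈ S, (ech (x j * a k) - ech (x k * a k))) t‖ ^ 2 ≤
      4 ^ S.card * ∫ t in A..(b + S.card * δ), ‖tsm x w t‖ ^ 2 := by
  induction S using Finset.induction_on with
  | empty => intro w b _; simp
  | insert k S hk ih =>
    intro w b hb
    have h1 := ih (fun j => w j * (ech (x j * a k) - ech (x k * a k))) b hb
    have h2 := one_step x w (x k) (a k) δ A (b + S.card * δ) (ha k) (haδ k)
      (by have : 0 ≤ (S.card : ℝ) * δ := by positivity
          linarith)
    have e1 : (fun j => w j * ∏ k ∈ insert k S, (ech (x j * a k) - ech (x k * a k)))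
      = (fun j => w j * (ech (x j * a k) - ech (x k * a k)) *
          ∏ k ∈ S, (ech (x j * a k) - ech (x k * a k))) := by
      funext j
      rw [Finset.prod_insert hk, mul_assoc]
    rw [e1, Finset.card_insert_of_notMem hk]
    have e2 : b + ((S.card + 1 : ℕ) : ℝ) * δ = b + S.card * δ + δ := by push_cast; ring
    rw [e2, pow_succ, mul_assoc]
    exact h1.trans (mul_le_mul_of_nonneg_left h2 (by positivity))

lemma norm_ech_sub (y z : ℝ) : ‖ech y - ech z‖ ^ 2 = 4 * Real.sin (π * (y - z)) ^ 2 := by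
  rw [← Complex.normSq_eq_norm_sq, Complex.normSq_apply, Complex.sub_re, Complex.sub_im,
    ech_re, ech_re, ech_im, ech_im]
  have h := Real.cos_sub (2 * π * y) (2 * π * z)
  have h2 : 2 * π * y - 2 * π * z = 2 * (π * (y - z)) := by ring
  rw [h2, Real.cos_two_mul] at h
  have h3 := Real.sin_sq_add_cos_sq (π * (y - z))
  have h4 := Real.sin_sq_add_cos_sq (2 * π * y)
  have h5 := Real.sin_sq_add_cos_sq (2 * π * z)
  nlinarith

lemma exists_shift (ε δ y z : ℝ) (hε : 0 < ε) (hδ : 0 < δ) (h : ε ≤ |y - z|) :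
    ∃ a, 0 ≤ a ∧ a ≤ δ ∧ min 1 ((4 * ε * δ) ^ 2) ≤ ‖ech (y * a) - ech (z * a)‖ ^ 2 := by
  have hd : 0 < |y - z| := hε.trans_le h
  have key : ∀ a, ‖ech (y * a) - ech (z * a)‖ ^ 2 = 4 * Real.sin (π * (|y - z| * a)) ^ 2 := by
    intro a
    rw [norm_ech_sub]
    rcases abs_cases (y - z) with ⟨h, _⟩ | ⟨h, _⟩
    · rw [h, sub_mul]
    · rw [h, neg_mul, mul_neg, Real.sin_neg, neg_sq, sub_mul]
  by_cases hc : 1 / 2 ≤ |y - z| * δ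
  · refine ⟨1 / (2 * |y - z|), by positivity, ?_, ?_⟩
    · rw [div_le_iff₀ (by positivity)]
      linarith
    · rw [key]
      have : π * (|y - z| * (1 / (2 * |y - z|))) = π / 2 := by field_simp
      rw [this, Real.sin_pi_div_two]
      exact (min_le_left _ _).trans (by norm_num)
  · refine ⟨δ, hδ.le, le_rfl, (min_le_right _ _).trans ?_⟩
    rw [key]
    push Not at hc
    have hs := Real.mul_le_sin (x := π * (|y - z| * δ)) (by positivity) (by nlinarith [pi_pos])
    have e : 2 / π * (π * (|y - z| * δ)) = 2 * (|y - z| * δ) := by field_simp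
    rw [e] at hs
    have h2 : ε * δ ≤ |y - z| * δ := mul_le_mul_of_nonneg_right h hδ.le
    have h3 : 0 < ε * δ := by positivity
    nlinarith

lemma integral_cos_sinc (u : ℝ) :
    ∫ t in (-(1/2) : ℝ)..(1/2), Real.cos (2 * π * u * t) = sinckernel u := by
  unfold sinckernel
  split_ifs with h
  · subst h; norm_num
  · have h0 : 2 * π * u ≠ 0 := by positivity
    rw [intervalIntegral.integral_comp_mul_left (fun t => Real.cos t) h0, integral_cos]
    have e1 : 2 * π * u * (1/2) = π * u := by ring
    have e2 : 2 * π * u * (-(1/2)) = -(π * u) := by ring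
    rw [e1, e2, Real.sin_neg, smul_eq_mul]
    field_simp
    ring

lemma quad_form {n : ℕ} (x : Fin n → ℝ) (v : Fin n → ℝ) :
    ∫ t in (-(1/2) : ℝ)..(1/2), ‖tsm x (fun j => (v j : ℂ)) t‖ ^ 2
      = ∑ i, ∑ j, v i * v j * sinckernel (x i - x j) := by
  have key : ∀ t, ‖tsm x (fun j => (v j : ℂ)) t‖ ^ 2
      = ∑ i, ∑ j, v i * v j * Real.cos (2 * π * (x i - x j) * t) := by
    intro t
    rw [← Complex.normSq_eq_norm_sq, Complex.normSq_apply]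
    unfold tsm
    rw [Complex.re_sum, Complex.im_sum, Finset.sum_mul_sum, Finset.sum_mul_sum,
      ← Finset.sum_add_distrib]
    refine Finset.sum_congr rfl fun i _ => ?_
    rw [← Finset.sum_add_distrib]
    refine Finset.sum_congr rfl fun j _ => ?_
    rw [Complex.re_ofReal_mul, Complex.re_ofReal_mul, Complex.im_ofReal_mul,
      Complex.im_ofReal_mul, ech_re, ech_re, ech_im, ech_im]
    have e : 2 * π * (x i - x j) * t = 2 * π * (x i * t) - 2 * π * (x j * t) := by ring
    rw [e, Real.cos_sub]
    ring
  simp_rw [key]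
  have hc : ∀ i j, Continuous fun t => v i * v j * Real.cos (2 * π * (x i - x j) * t) := by
    intro i j; fun_prop
  rw [intervalIntegral.integral_finsetSum
    (fun i _ => (continuous_finsetSum _ fun j _ => hc i j).intervalIntegrable _ _)]
  refine Finset.sum_congr rfl fun i _ => ?_
  rw [intervalIntegral.integral_finsetSum (fun j _ => (hc i j).intervalIntegrable _ _)]
  refine Finset.sum_congr rfl fun j _ => ?_
  rw [intervalIntegral.integral_const_mul, integral_cos_sinc]

lemma coord_bound (n : ℕ) (hn : 0 < n) (ε : ℝ) (hε : 0 < ε) :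
    ∃ c > (0:ℝ), ∀ x : Fin n → ℝ, (∀ i j : Fin n, i ≠ j → ε ≤ |x i - x j|) →
      ∀ (v : Fin n → ℝ) (j : Fin n), c * v j ^ 2 ≤ ∑ i, ∑ j, v i * v j * sinckernel (x i - x j) := by
  set δ : ℝ := 1 / (2 * n) with hδ
  have hn' : (0:ℝ) < n := by exact_mod_cast hn
  have hδ0 : 0 < δ := by positivity
  set κ : ℝ := min 1 ((4 * ε * δ) ^ 2) with hκ
  have hκ0 : 0 < κ := lt_min one_pos (by positivity)
  refine ⟨κ ^ (n - 1) / 2 / 4 ^ (n - 1), by positivity, fun x hx v j => ?_⟩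
  have hex : ∀ k, ∃ a, 0 ≤ a ∧ a ≤ δ ∧ (k ≠ j → κ ≤ ‖ech (x j * a) - ech (x k * a)‖ ^ 2) := by
    intro k
    by_cases hk : k = j
    · exact ⟨0, le_rfl, hδ0.le, fun h => absurd hk h⟩
    · obtain ⟨a, h1, h2, h3⟩ := exists_shift ε δ (x j) (x k) hε hδ0 (hx j k (Ne.symm hk))
      exact ⟨a, h1, h2, fun _ => h3⟩
  choose a ha haδ haκ using hex
  have hcard : (Finset.univ.erase j).card = n - 1 := by
    rw [Finset.card_erase_of_mem (Finset.mem_univ j), Finset.card_univ, Fintype.card_fin]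
  have hm := multi_step x a δ (-(1/2)) ha haδ hδ0.le (Finset.univ.erase j)
    (fun j => (v j : ℂ)) 0 (by norm_num)
  rw [hcard] at hm
  have hnd : ((n - 1 : ℕ) : ℝ) * δ ≤ 1 / 2 := by
    have h1 : ((n - 1 : ℕ) : ℝ) ≤ n := by exact_mod_cast Nat.sub_le n 1
    calc ((n - 1 : ℕ) : ℝ) * δ ≤ n * δ := mul_le_mul_of_nonneg_right h1 hδ0.le
      _ = 1 / 2 := by rw [hδ]; field_simp
  have hnd0 : 0 ≤ ((n - 1 : ℕ) : ℝ) * δ := by positivity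
  have hmono := mono_tsm x (fun j => (v j : ℂ)) (-(1/2)) (0 + ((n - 1 : ℕ) : ℝ) * δ) (-(1/2)) (1/2)
    le_rfl (by linarith) (by linarith)
  rw [quad_form] at hmono
  have hval : ∀ t, ‖tsm x (fun i => (v i : ℂ) * ∏ k ∈ Finset.univ.erase j,
      (ech (x i * a k) - ech (x k * a k))) t‖ ^ 2
      = v j ^ 2 * ∏ k ∈ Finset.univ.erase j, ‖ech (x j * a k) - ech (x k * a k)‖ ^ 2 := by
    intro t
    unfold tsm
    rw [Finset.sum_eq_single j]
    · rw [norm_mul, norm_mul, norm_ech, mul_one, mul_pow, norm_prod, Finset.prod_pow,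
        Complex.norm_real, Real.norm_eq_abs, sq_abs]
    · intro i _ hi
      beta_reduce
      rw [Finset.prod_eq_zero (i := i) (by simp [hi]) (by simp)]
      simp
    · simp
  simp_rw [hval] at hm
  rw [intervalIntegral.integral_const] at hm
  have hprod : κ ^ (n - 1) ≤
      ∏ k ∈ Finset.univ.erase j, ‖ech (x j * a k) - ech (x k * a k)‖ ^ 2 := by
    rw [← hcard, ← Finset.prod_const]
    exact Finset.prod_le_prod (fun _ _ => hκ0.le) fun k hk => haκ k (Finset.ne_of_mem_erase hk)
  have h4 : (0:ℝ) < 4 ^ (n - 1) := by positivity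
  have h5 := mul_le_mul_of_nonneg_left hmono h4.le
  have h6 := mul_le_mul_of_nonneg_left hprod (sq_nonneg (v j))
  rw [smul_eq_mul] at hm
  rw [div_mul_eq_mul_div, div_le_iff₀ h4]
  linarith

lemma sinckernel_neg (u : ℝ) : sinckernel (-u) = sinckernel u := by
  unfold sinckernel
  simp [neg_div_neg_eq]

theorem stmt_8 (n : ℕ) (hn : 2 ≤ n) (ε : ℝ) (hε : 0 < ε) :
    ∃ c > (0:ℝ), ∀ x : Fin n → ℝ,
      (∀ i j : Fin n, i ≠ j → ε ≤ |x i - x j|) → c ≤ Wdet n x := by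
  obtain ⟨c, hc, hb⟩ := coord_bound n (by omega) ε hε
  have hn' : (0:ℝ) < n := by exact_mod_cast (by omega : 0 < n)
  refine ⟨(c / n) ^ n, by positivity, fun x hx => ?_⟩
  have hH : (Matrix.of fun i j => sinckernel (x i - x j)).IsHermitian := by
    ext i j
    simp only [Matrix.conjTranspose_apply, Matrix.of_apply, star_trivial]
    rw [← sinckernel_neg, neg_sub]
  unfold Wdet
  rw [hH.det_eq_prod_eigenvalues]
  have hev : ∀ i, c / n ≤ hH.eigenvalues i := by
    intro i
    set v : Fin n → ℝ := fun j => hH.eigenvectorBasis i j with hv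
    have hnorm : ∑ j, v j ^ 2 = 1 := by
      have h := hH.eigenvectorBasis.orthonormal.1 i
      have h2 := EuclideanSpace.norm_sq_eq (hH.eigenvectorBasis i)
      rw [h] at h2
      simpa [hv] using h2.symm
    have hq : hH.eigenvalues i = ∑ i, ∑ j, v i * v j * sinckernel (x i - x j) := by
      rw [hH.eigenvalues_eq]
      simp [dotProduct, Matrix.mulVec, Finset.mul_sum, hv]
      refine Finset.sum_congr rfl fun a _ => Finset.sum_congr rfl fun b _ => ?_
      ring
    rw [hq, div_le_iff₀ hn']
    have hs := Finset.sum_le_sum fun j (_ : j ∈ Finset.univ) => hb x hx v j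
    rw [← Finset.mul_sum, hnorm] at hs
    simp only [Finset.sum_const, Finset.card_univ, Fintype.card_fin, nsmul_eq_mul] at hs
    linarith
  calc (c / n) ^ n = ∏ _i : Fin n, c / (n:ℝ) := by simp [div_pow]
    _ ≤ _ := Finset.prod_le_prod (fun _ _ => by positivity) fun i _ => by simpa using hev i
end
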